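/- arXiv:math/0603555 — 9 statements merged into one kernel-verified Lean document; each statement's English description precedes it below -/
import Mathlib

section
/- Let F(x,y) = a₄₀x⁴ + 4a₃₁x³y + 6a₂₂x²y² + 4a₁₃xy³ + a₀₄y⁴ be a nonzero binary quartic form over ℂ, and set σ = a₄₀a₀₄ − 4a₃₁a₁₃ + 3a₂₂² and ψ = a₄₀a₂₂a₀₄ − a₄₀a₁₃² − a₃₁²a₀₄ + 2a₃₁a₂₂a₁₃ − a₂₂³. Then σ³ − 27ψ² = 0 if and only if F has a repeated linear factor, i.e. there exists a nonzero linear form ℓ(x,y) over ℂ with ℓ² dividing F. (The quantity σ³ − 27ψ² is the discriminant of F up to a nonzero scalar.) -/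
open MvPolynomial

lemma bq_quad (a b c : ℂ) (ha : a ≠ 0) : ∃ r s : ℂ, b = -a * (r + s) ∧ c = a * (r * s) := by
  obtain ⟨r, hr⟩ := IsAlgClosed.exists_root
    (Polynomial.C a * Polynomial.X ^ 2 + Polynomial.C b * Polynomial.X + Polynomial.C c)
    (by rw [Polynomial.degree_quadratic ha]; norm_num)
  simp [Polynomial.IsRoot] at hr
  refine ⟨r, -b / a - r, ?_, ?_⟩
  · field_simp; ring
  · field_simp; linear_combination hr

lemma bq_cubic (a b c d : ℂ) (ha : a ≠ 0) : ∃ r s t : ℂ, b = -a * (r + s + t) ∧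
    c = a * (r * s + r * t + s * t) ∧ d = -a * (r * s * t) := by
  obtain ⟨r, hr⟩ := IsAlgClosed.exists_root
    (Polynomial.C a * Polynomial.X ^ 3 + Polynomial.C b * Polynomial.X ^ 2
      + Polynomial.C c * Polynomial.X + Polynomial.C d)
    (by rw [Polynomial.degree_cubic ha]; norm_num)
  simp [Polynomial.IsRoot] at hr
  obtain ⟨s, t, h1, h2⟩ := bq_quad a (b + a * r) (c + b * r + a * r ^ 2) ha
  refine ⟨r, s, t, ?_, ?_, ?_⟩
  · linear_combination h1
  · linear_combination h2 - r * h1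
  · linear_combination hr - r * h2

lemma bq_quartic (a b c d e : ℂ) (ha : a ≠ 0) : ∃ r s t u : ℂ, b = -a * (r + s + t + u) ∧
    c = a * (r * s + r * t + s * t + u * (r + s + t)) ∧
    d = -a * (r * s * t + u * (r * s + r * t + s * t)) ∧ e = a * (r * s * t * u) := by
  obtain ⟨u, hu⟩ := IsAlgClosed.exists_root
    (Polynomial.C a * Polynomial.X ^ 4 + (Polynomial.C b * Polynomial.X ^ 3
      + Polynomial.C c * Polynomial.X ^ 2 + Polynomial.C d * Polynomial.X + Polynomial.C e))
    (by
      rw [Polynomial.degree_add_eq_left_of_degree_lt]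
      · rw [Polynomial.degree_C_mul_X_pow 4 ha]; norm_num
      · rw [Polynomial.degree_C_mul_X_pow 4 ha]
        exact lt_of_le_of_lt Polynomial.degree_cubic_le (by norm_num))
  simp [Polynomial.IsRoot] at hu
  obtain ⟨r, s, t, h1, h2, h3⟩ := bq_cubic a (b + a * u) (c + b * u + a * u ^ 2)
    (d + c * u + b * u ^ 2 + a * u ^ 3) ha
  refine ⟨r, s, t, u, ?_, ?_, ?_, ?_⟩
  · linear_combination h1
  · linear_combination h2 - u * h1
  · linear_combination h3 - u * h2
  · linear_combination hu - u * h3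

lemma bq_lin_ne (r : ℂ) : (X 0 - C r * X 1 : MvPolynomial (Fin 2) ℂ) ≠ 0 := by
  intro h
  have := congrArg (eval ![1, 0]) h
  simp at this

lemma bq_lin_hom (r : ℂ) : (X 0 - C r * X 1 : MvPolynomial (Fin 2) ℂ).IsHomogeneous 1 := by
  apply (isHomogeneous_X _ _).sub
  simpa using (isHomogeneous_C (Fin 2) r).mul (isHomogeneous_X ℂ (1 : Fin 2))

/-- Quartic with a double root `r` and further roots `s`, `t`. -/
lemma bq_double (a b c d e r s t : ℂ)
    (hb : 4 * b = -a * (r + r + s + t))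
    (hc : 6 * c = a * (r * r + r * s + r * s + t * (r + r + s)))
    (hd : 4 * d = -a * (r * r * s + t * (r * r + r * s + r * s)))
    (he : e = a * (r * r * s * t)) :
    ∃ ℓ : MvPolynomial (Fin 2) ℂ, ℓ ≠ 0 ∧ ℓ.IsHomogeneous 1 ∧
        ℓ ^ 2 ∣ (C a * X 0 ^ 4 + C (4 * b) * X 0 ^ 3 * X 1 +
          C (6 * c) * X 0 ^ 2 * X 1 ^ 2 + C (4 * d) * X 0 * X 1 ^ 3 +
          C e * X 1 ^ 4 : MvPolynomial (Fin 2) ℂ) := by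
  refine ⟨X 0 - C r * X 1, bq_lin_ne r, bq_lin_hom r,
    C a * (X 0 - C s * X 1) * (X 0 - C t * X 1), ?_⟩
  rw [hb, hc, hd, he]
  simp only [map_mul, map_add, map_neg]
  ring

lemma bq_double_cubic (b c d e r s : ℂ)
    (hc : 6 * c = -(4 * b) * (r + r + s))
    (hd : 4 * d = (4 * b) * (r * r + r * s + r * s))
    (he : e = -(4 * b) * (r * r * s)) :
    ∃ ℓ : MvPolynomial (Fin 2) ℂ, ℓ ≠ 0 ∧ ℓ.IsHomogeneous 1 ∧
        ℓ ^ 2 ∣ (C 0 * X 0 ^ 4 + C (4 * b) * X 0 ^ 3 * X 1 +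
          C (6 * c) * X 0 ^ 2 * X 1 ^ 2 + C (4 * d) * X 0 * X 1 ^ 3 +
          C e * X 1 ^ 4 : MvPolynomial (Fin 2) ℂ) := by
  refine ⟨X 0 - C r * X 1, bq_lin_ne r, bq_lin_hom r,
    C (4 * b) * X 1 * (X 0 - C s * X 1), ?_⟩
  rw [hc, hd, he]
  simp only [map_mul, map_add, map_neg, map_zero]
  ring

/-- For a nonzero binary quartic `F = a₄₀x⁴ + 4a₃₁x³y + 6a₂₂x²y² + 4a₁₃xy³ + a₀₄y⁴`
over ℂ, with `σ = a₄₀a₀₄ − 4a₃₁a₁₃ + 3a₂₂²` and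
`ψ = a₄₀a₂₂a₀₄ − a₄₀a₁₃² − a₃₁²a₀₄ + 2a₃₁a₂₂a₁₃ − a₂₂³`, the discriminant
`σ³ − 27ψ²` vanishes if and only if `F` has a repeated linear factor. -/
theorem binary_quartic_discriminant (a40 a31 a22 a13 a04 : ℂ)
    (hF : (C a40 * X 0 ^ 4 + C (4 * a31) * X 0 ^ 3 * X 1 +
        C (6 * a22) * X 0 ^ 2 * X 1 ^ 2 + C (4 * a13) * X 0 * X 1 ^ 3 +
        C a04 * X 1 ^ 4 : MvPolynomial (Fin 2) ℂ) ≠ 0) :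
    ((a40 * a04 - 4 * a31 * a13 + 3 * a22 ^ 2) ^ 3 -
        27 * (a40 * a22 * a04 - a40 * a13 ^ 2 - a31 ^ 2 * a04 +
          2 * a31 * a22 * a13 - a22 ^ 3) ^ 2 = 0
      ↔
      ∃ ℓ : MvPolynomial (Fin 2) ℂ, ℓ ≠ 0 ∧ ℓ.IsHomogeneous 1 ∧
        ℓ ^ 2 ∣ (C a40 * X 0 ^ 4 + C (4 * a31) * X 0 ^ 3 * X 1 +
          C (6 * a22) * X 0 ^ 2 * X 1 ^ 2 + C (4 * a13) * X 0 * X 1 ^ 3 +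
          C a04 * X 1 ^ 4 : MvPolynomial (Fin 2) ℂ)) := by
  constructor
  · intro h
    by_cases ha : a40 = 0
    · subst ha
      by_cases hb : a31 = 0
      · subst hb
        refine ⟨X 1, X_ne_zero _, isHomogeneous_X _ _,
          C (6 * a22) * X 0 ^ 2 + C (4 * a13) * X 0 * X 1 + C a04 * X 1 ^ 2, ?_⟩
        simp only [mul_zero, map_zero]
        ring
      · obtain ⟨r, s, t, h1, h2, h3⟩ := bq_cubic (4 * a31) (6 * a22) (4 * a13) a04
          (mul_ne_zero (by norm_num) hb)
        have e1 : a22 = -(4 * a31) * (r + s + t) / 6 := by linear_combination h1 / 6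
        have e2 : a13 = a31 * (r * s + r * t + s * t) := by linear_combination h2 / 4
        have key : a31 ^ 6 * ((r - s) * (r - t) * (s - t)) ^ 2 = 0 := by
          rw [e1, e2, h3] at h
          linear_combination h / 16
        have : (r - s) * (r - t) * (s - t) = 0 := by simpa [hb] using key
        rcases mul_eq_zero.1 this with h' | h'
        · rcases mul_eq_zero.1 h' with h' | h' <;> obtain rfl := sub_eq_zero.1 h'
          · exact bq_double_cubic _ _ _ _ r t (by linear_combination h1)
              (by linear_combination h2) (by linear_combination h3)
          · exact bq_double_cubic _ _ _ _ r s (by linear_combination h1)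
              (by linear_combination h2) (by linear_combination h3)
        · obtain rfl := sub_eq_zero.1 h'
          exact bq_double_cubic _ _ _ _ s r (by linear_combination h1)
              (by linear_combination h2) (by linear_combination h3)
    · obtain ⟨r, s, t, u, h1, h2, h3, h4⟩ :=
        bq_quartic a40 (4 * a31) (6 * a22) (4 * a13) a04 ha
      have e1 : a31 = -a40 * (r + s + t + u) / 4 := by linear_combination h1 / 4
      have e2 : a22 = a40 * (r * s + r * t + s * t + u * (r + s + t)) / 6 := by
        linear_combination h2 / 6
      have e3 : a13 = -a40 * (r * s * t + u * (r * s + r * t + s * t)) / 4 := by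
        linear_combination h3 / 4
      have key : a40 ^ 6 * ((r - s) * (r - t) * (r - u) * (s - t) * (s - u) * (t - u)) ^ 2 = 0 := by
        rw [e1, e2, e3, h4] at h
        linear_combination 256 * h
      have : (r - s) * (r - t) * (r - u) * (s - t) * (s - u) * (t - u) = 0 := by
        simpa [ha] using key
      simp only [mul_eq_zero, sub_eq_zero] at this
      rcases this with ((((rfl | rfl) | rfl) | rfl) | rfl) | rfl
      · exact bq_double _ _ _ _ _ r t u (by linear_combination h1) (by linear_combination h2)
          (by linear_combination h3) (by linear_combination h4)
      · exact bq_double _ _ _ _ _ r s u (by linear_combination h1) (by linear_combination h2)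
          (by linear_combination h3) (by linear_combination h4)
      · exact bq_double _ _ _ _ _ r s t (by linear_combination h1) (by linear_combination h2)
          (by linear_combination h3) (by linear_combination h4)
      · exact bq_double _ _ _ _ _ s r u (by linear_combination h1) (by linear_combination h2)
          (by linear_combination h3) (by linear_combination h4)
      · exact bq_double _ _ _ _ _ s r t (by linear_combination h1) (by linear_combination h2)
          (by linear_combination h3) (by linear_combination h4)
      · exact bq_double _ _ _ _ _ t r s (by linear_combination h1) (by linear_combination h2)
          (by linear_combination h3) (by linear_combination h4)
  · rintro ⟨ℓ, hne, hhom, G, hG⟩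
    have hmem : ℓ ∈ homogeneousSubmodule (Fin 2) ℂ 1 := hhom
    rw [homogeneousSubmodule_one_eq_span_X, Submodule.mem_span_range_iff_exists_fun] at hmem
    obtain ⟨c, hc⟩ := hmem
    rw [Fin.sum_univ_two] at hc
    have hl : eval ![c 1, -c 0] ℓ = 0 := by
      rw [← hc]; simp [smul_eval]; ring
    have hx := congrArg (fun P => eval ![c 1, -c 0] (pderiv 0 P)) hG
    have hy := congrArg (fun P => eval ![c 1, -c 0] (pderiv 1 P)) hG
    have hcc : ¬ (c 1 = 0 ∧ -c 0 = 0) := by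
      rintro ⟨h1, h0⟩
      apply hne
      rw [← hc, h1, neg_eq_zero.1 h0]; simp
    generalize c 1 = u at *
    generalize -c 0 = v at *
    simp [pderiv_X, Derivation.leibniz, Derivation.leibniz_pow, hl, Pi.single_apply] at hx hy
    have hx' : a40 * u ^ 3 + 3 * a31 * u ^ 2 * v + 3 * a22 * u * v ^ 2 + a13 * v ^ 3 = 0 := by
      linear_combination hx / 4
    have hy' : a31 * u ^ 3 + 3 * a22 * u ^ 2 * v + 3 * a13 * u * v ^ 2 + a04 * v ^ 3 = 0 := by
      linear_combination hy / 4
    by_cases hv : v = 0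
    · subst hv
      have hu : u ≠ 0 := fun h => hcc ⟨h, rfl⟩
      have h1 : a40 = 0 := by simpa [hu] using hx'
      have h2 : a31 = 0 := by simpa [hu] using hy'
      rw [h1, h2]; ring
    · obtain ⟨t, rfl⟩ : ∃ t, u = t * v := ⟨u / v, by field_simp⟩
      have hv3 : v ^ 3 ≠ 0 := pow_ne_zero _ hv
      have e1 : a13 = -(a40 * t ^ 3 + 3 * a31 * t ^ 2 + 3 * a22 * t) := by
        apply mul_right_cancel₀ hv3
        linear_combination hx'
      have e2 : a04 = -(a31 * t ^ 3 + 3 * a22 * t ^ 2 + 3 * a13 * t) := by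
        apply mul_right_cancel₀ hv3
        linear_combination hy'
      rw [e2, e1]; ring
end

section
/- Let i ∈ ℂ with i² = −1, let σ(t) = i(t−1)/(t+1), and let z(t) = (−(1+i)t³ + 3t² − i)/(t² + (1−i)t − i), noting that t² + (1−i)t − i = (t+1)(t−i). Then for every t ∈ ℂ with t ≠ −1 and t ≠ i, one has σ(σ(σ(t))) = t (σ is an automorphism of order 3) and z(σ(t)) = z(t) (the function z is invariant under σ). -/
/-- For the stratum `Z₄`: the parameter change `σ(t) = i(t−1)/(t+1)` has
order 3, and the quotient map `z(t) = (−(1+i)t³ + 3t² − i)/(t² + (1−i)t − i)`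
is invariant under `σ`. -/
theorem Z4_order_three_automorphism (i : ℂ) (hi : i ^ 2 = -1)
    (t : ℂ) (ht1 : t ≠ -1) (hti : t ≠ i) :
    let σ : ℂ → ℂ := fun s => i * (s - 1) / (s + 1)
    let z : ℂ → ℂ := fun s =>
      (-(1 + i) * s ^ 3 + 3 * s ^ 2 - i) / (s ^ 2 + (1 - i) * s - i)
    σ (σ (σ t)) = t ∧ z (σ t) = z t := by
  intro σ z
  have h1 : t + 1 ≠ 0 := fun h => ht1 (eq_neg_of_add_eq_zero_left h)
  have h2 : t - i ≠ 0 := sub_ne_zero.mpr hti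
  have hi0 : i ≠ 0 := by
    rintro rfl
    norm_num at hi
  have h3 : 1 + i ≠ 0 := by
    intro h
    have h' : i = -1 := by linear_combination h
    rw [h'] at hi
    norm_num at hi
  have e1 : σ t + 1 = (1 + i) * (t - i) / (t + 1) := by
    simp only [σ]
    rw [eq_div_iff h1, add_mul, div_mul_cancel₀ _ h1]
    linear_combination hi
  have e2 : σ t - i = -2 * i / (t + 1) := by
    simp only [σ]
    rw [eq_div_iff h1, sub_mul, div_mul_cancel₀ _ h1]
    ring
  have n1 : σ t + 1 ≠ 0 := by
    rw [e1]
    exact div_ne_zero (mul_ne_zero h3 h2) h1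
  have n2 : σ t - i ≠ 0 := by
    rw [e2]
    exact div_ne_zero (mul_ne_zero (by norm_num) hi0) h1
  have hs : σ t * (t + 1) = i * (t - 1) := div_mul_cancel₀ _ h1
  have e3 : σ (σ t) = -(t + i) / (t - i) := by
    change i * (σ t - 1) / (σ t + 1) = _
    rw [div_eq_div_iff n1 h2]
    apply mul_right_cancel₀ h1
    linear_combination (i * (t - i) + (t + i)) * hs + (t ^ 2 + t - i * t + i) * hi
  have e4 : σ (σ t) + 1 = -2 * i / (t - i) := by
    rw [e3, eq_div_iff h2, add_mul, div_mul_cancel₀ _ h2]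
    ring
  have n3 : σ (σ t) + 1 ≠ 0 := by
    rw [e4]
    exact div_ne_zero (mul_ne_zero (by norm_num) hi0) h2
  constructor
  · change i * (σ (σ t) - 1) / (σ (σ t) + 1) = t
    rw [div_eq_iff n3, e4, e3]
    field_simp
    ring
  · have d1 : t ^ 2 + (1 - i) * t - i ≠ 0 := by
      have : t ^ 2 + (1 - i) * t - i = (t + 1) * (t - i) := by ring
      rw [this]
      exact mul_ne_zero h1 h2
    have d2 : (σ t) ^ 2 + (1 - i) * σ t - i ≠ 0 := by
      have : (σ t) ^ 2 + (1 - i) * σ t - i = (σ t + 1) * (σ t - i) := by ring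
      rw [this]
      exact mul_ne_zero n1 n2
    change (-(1 + i) * (σ t) ^ 3 + 3 * (σ t) ^ 2 - i) / ((σ t) ^ 2 + (1 - i) * σ t - i) = _
    rw [div_eq_div_iff d2 d1]
    have hi3 : i ^ 3 = -i := by linear_combination i * hi
    have hi4 : i ^ 4 = 1 := by linear_combination (i ^ 2 - 1) * hi
    have hi5 : i ^ 5 = i := by linear_combination (i ^ 3 - i) * hi
    have hst : σ t = i * (t - 1) / (t + 1) := rfl
    rw [hst]
    field_simp
    ring_nf
    simp only [hi, hi3, hi4, hi5]
    ring
end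

section
/- Let i ∈ ℂ with i² = −1, let σ(t) = i(t−1)/(t+1), and for t ∈ ℂ with t ∉ {−1, i} set z = (−(1+i)t³ + 3t² − i)/((t+1)(t−i)). Then one has the polynomial identity in the variable T: −(1+i)T³ + 3T² − i − z·(T² + (1−i)T − i) = −(1+i)·(T − t)(T − σ(t))(T − σ(σ(t))). In particular the fiber of the quotient map t ↦ z(t) through t is exactly the orbit {t, σ(t), σ²(t)} of the order-3 automorphism σ. -/
open Polynomial

/-- For the stratum `Z₄`: with `σ(t) = i(t−1)/(t+1)` and
`z = (−(1+i)t³ + 3t² − i)/((t+1)(t−i))`, one has the polynomial identity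
`−(1+i)T³ + 3T² − i − z(T² + (1−i)T − i) = −(1+i)(T−t)(T−σ(t))(T−σ²(t))`;
in particular the fiber of `t ↦ z(t)` through `t` is exactly the orbit
`{t, σ(t), σ²(t)}` of the order-3 automorphism `σ`. -/
theorem Z4_fiber_is_orbit (i : ℂ) (hi : i ^ 2 = -1)
    (t : ℂ) (ht1 : t ≠ -1) (hti : t ≠ i) :
    let σ : ℂ → ℂ := fun s => i * (s - 1) / (s + 1)
    let z : ℂ := (-(1 + i) * t ^ 3 + 3 * t ^ 2 - i) / ((t + 1) * (t - i))
    (C (-(1 + i)) * X ^ 3 + C 3 * X ^ 2 - C i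
        - C z * (X ^ 2 + C (1 - i) * X - C i)
      = C (-(1 + i)) *
          ((X - C t) * (X - C (σ t)) * (X - C (σ (σ t))))) ∧
    (∀ w : ℂ,
      -(1 + i) * w ^ 3 + 3 * w ^ 2 - i - z * (w ^ 2 + (1 - i) * w - i) = 0 ↔
        (w = t ∨ w = σ t ∨ w = σ (σ t))) := by
  intro σ z
  have h1 : t + 1 ≠ 0 := fun h => ht1 (eq_neg_of_add_eq_zero_left h)
  have h2 : t - i ≠ 0 := sub_ne_zero.mpr hti
  have h3 : (1 + i) ≠ 0 := by
    intro h
    have h' : i = -1 := by linear_combination h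
    rw [h'] at hi
    norm_num at hi
  have hs1 : σ t + 1 = (1 + i) * (t - i) / (t + 1) := by
    simp only [σ]
    field_simp
    linear_combination hi
  have hs1' : σ t + 1 ≠ 0 := by
    rw [hs1]
    exact div_ne_zero (mul_ne_zero h3 h2) h1
  have hs : σ t = i * (t - 1) / (t + 1) := rfl
  have hss : σ (σ t) = (-t - i) / (t - i) := by
    change i * (σ t - 1) / (σ t + 1) = _
    rw [div_eq_div_iff hs1' h2, hs]
    field_simp
    ring_nf
    have e3 : i ^ 3 = -i := by linear_combination i * hi
    simp only [e3, hi]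
    ring
  have key : ∀ w : ℂ,
      -(1 + i) * w ^ 3 + 3 * w ^ 2 - i - z * (w ^ 2 + (1 - i) * w - i)
        = -(1 + i) * ((w - t) * (w - σ t) * (w - σ (σ t))) := by
    intro w
    rw [hss, hs]
    simp only [z]
    field_simp
    ring_nf
    have e3 : i ^ 3 = -i := by linear_combination i * hi
    simp only [e3, hi]
    ring
  refine ⟨?_, ?_⟩
  · apply Polynomial.funext
    intro w
    have := key w
    simp only [eval_sub, eval_add, eval_mul, eval_C, eval_pow, eval_X]
    exact this
  · intro w
    rw [key w]
    simp only [mul_eq_zero, neg_eq_zero, h3, false_or, sub_eq_zero, or_assoc]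
end

section
/- Let z ∈ ℂ with z ≠ 0 and z² − 12z + 9 ≠ 0, and set i₁ = (z−3)(5z−3)/(4z²) and i₂ = (79z⁵ − 1059z⁴ − 2670z³ + 12366z² − 13203z + 4455)/(16(z²−12z+9)z³). If 53680 i₁³ − 10560 i₁² i₂ + 10120 i₁² − 57750 i₁ + 7920 i₂ − 6105 ≠ 0, then z = −165(880 i₁³ + 1336 i₁² − 558 i₁ − 1047)/(53680 i₁³ − 10560 i₁² i₂ + 10120 i₁² − 57750 i₁ + 7920 i₂ − 6105). Hence z is a rational function of (i₁, i₂) and generates the function field of the stratum Z₄. -/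
/-- On the stratum `Z₄`, the coordinate `z` is recovered as a rational
function of the first two absolute Dixmier–Ohno invariants
`i₁ = (z−3)(5z−3)/(4z²)` and
`i₂ = (79z⁵−1059z⁴−2670z³+12366z²−13203z+4455)/(16(z²−12z+9)z³)`. -/
theorem Z4_z_rational_in_invariants (z : ℂ) (hz : z ≠ 0)
    (hz2 : z ^ 2 - 12 * z + 9 ≠ 0) :
    let i₁ : ℂ := (z - 3) * (5 * z - 3) / (4 * z ^ 2)
    let i₂ : ℂ := (79 * z ^ 5 - 1059 * z ^ 4 - 2670 * z ^ 3 + 12366 * z ^ 2 -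
        13203 * z + 4455) / (16 * (z ^ 2 - 12 * z + 9) * z ^ 3)
    53680 * i₁ ^ 3 - 10560 * i₁ ^ 2 * i₂ + 10120 * i₁ ^ 2 - 57750 * i₁ +
        7920 * i₂ - 6105 ≠ 0 →
      z = -165 * (880 * i₁ ^ 3 + 1336 * i₁ ^ 2 - 558 * i₁ - 1047) /
          (53680 * i₁ ^ 3 - 10560 * i₁ ^ 2 * i₂ + 10120 * i₁ ^ 2 -
            57750 * i₁ + 7920 * i₂ - 6105) := by
  intro i₁ i₂ h
  rw [eq_div_iff h]
  simp only [i₁, i₂]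
  clear h i₁ i₂
  generalize hw : z ^ 2 - 12 * z + 9 = w at hz2 ⊢
  field_simp
  subst hw
  ring
end

section
/- Let z ∈ ℂ with z ≠ 0 and z² − 12z + 9 ≠ 0, and set i₁ = (z−3)(5z−3)/(4z²) and i₂ = (79z⁵ − 1059z⁴ − 2670z³ + 12366z² − 13203z + 4455)/(16(z²−12z+9)z³). Then the following polynomial relation holds identically: 193600 i₁⁵ − 35776 i₁⁴ + 86784 i₁³ i₂ − 961040 i₁³ − 2304 i₁² i₂² + 100608 i₁² i₂ − 526608 i₁² − 65376 i₁ i₂ + 721521 i₁ + 1728 i₂² − 78048 i₂ + 515889 = 0. (This is the modular equation 193600 I₆⁵ − 35776 I₃²I₆⁴ + 86784 I₃I₆³I₉ − 961040 I₃⁴I₆³ − 2304 I₆²I₉² + 100608 I₃³I₆²I₉ − 526608 I₃⁶I₆² − 65376 I₃⁵I₆I₉ + 721521 I₃⁸I₆ + 1728 I₃⁴I₉² − 78048 I₃⁷I₉ + 515889 I₃¹⁰ = 0 for the stratum Z₄ after normalizing I₃ = 1.) -/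
set_option maxHeartbeats 4000000 in
/-- The modular equation of the stratum `Z₄`: the absolute Dixmier–Ohno
invariants `i₁ = (z−3)(5z−3)/(4z²)` and
`i₂ = (79z⁵−1059z⁴−2670z³+12366z²−13203z+4455)/(16(z²−12z+9)z³)` satisfy
`193600 i₁⁵ − 35776 i₁⁴ + 86784 i₁³i₂ − 961040 i₁³ − 2304 i₁²i₂² +
100608 i₁²i₂ − 526608 i₁² − 65376 i₁i₂ + 721521 i₁ + 1728 i₂² − 78048 i₂ +
515889 = 0`. -/
theorem Z4_modular_equation (z : ℂ) (hz : z ≠ 0)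
    (hz2 : z ^ 2 - 12 * z + 9 ≠ 0) :
    let i₁ : ℂ := (z - 3) * (5 * z - 3) / (4 * z ^ 2)
    let i₂ : ℂ := (79 * z ^ 5 - 1059 * z ^ 4 - 2670 * z ^ 3 + 12366 * z ^ 2 -
        13203 * z + 4455) / (16 * (z ^ 2 - 12 * z + 9) * z ^ 3)
    193600 * i₁ ^ 5 - 35776 * i₁ ^ 4 + 86784 * i₁ ^ 3 * i₂ - 961040 * i₁ ^ 3 -
        2304 * i₁ ^ 2 * i₂ ^ 2 + 100608 * i₁ ^ 2 * i₂ - 526608 * i₁ ^ 2 -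
        65376 * i₁ * i₂ + 721521 * i₁ + 1728 * i₂ ^ 2 - 78048 * i₂ +
        515889 = 0 := by
  intro i₁ i₂
  simp only [i₁, i₂]
  clear i₁ i₂
  generalize hw : z ^ 2 - 12 * z + 9 = w at hz2 ⊢
  field_simp
  rw [← hw]
  ring
end

section
/- Let i ∈ ℂ with i² = −1, let t ∈ ℂ with t ∉ {−1, i}, and set z = (−(1+i)t³ + 3t² − i)/((t+1)(t−i)). Then t is a root of the degree-six polynomial 2T⁶ + 2(z−3)T⁵ + (z−3)²T⁴ + 2(z² − 4z + 1)T³ + 2z²T² + 2z(z−1)T + (z−1)², i.e. 2t⁶ + 2(z−3)t⁵ + (z−3)²t⁴ + 2(z² − 4z + 1)t³ + 2z²t² + 2z(z−1)t + (z−1)² = 0. -/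
/-- Given the invariant `z = (−(1+i)t³ + 3t² − i)/((t+1)(t−i))` of a point of
the stratum `Z₄`, the parameter `t` is a root of the degree-six polynomial
`2T⁶ + 2(z−3)T⁵ + (z−3)²T⁴ + 2(z²−4z+1)T³ + 2z²T² + 2z(z−1)T + (z−1)²`. -/
theorem Z4_parameter_sextic (i : ℂ) (hi : i ^ 2 = -1)
    (t : ℂ) (ht1 : t ≠ -1) (hti : t ≠ i) :
    let z : ℂ := (-(1 + i) * t ^ 3 + 3 * t ^ 2 - i) / ((t + 1) * (t - i))
    2 * t ^ 6 + 2 * (z - 3) * t ^ 5 + (z - 3) ^ 2 * t ^ 4 +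
        2 * (z ^ 2 - 4 * z + 1) * t ^ 3 + 2 * z ^ 2 * t ^ 2 +
        2 * z * (z - 1) * t + (z - 1) ^ 2 = 0 := by
  intro z
  have h1 : t + 1 ≠ 0 := fun h => ht1 (eq_neg_of_add_eq_zero_left h)
  have h2 : t - i ≠ 0 := sub_ne_zero.mpr hti
  have hz : z * ((t + 1) * (t - i)) = -(1 + i) * t ^ 3 + 3 * t ^ 2 - i :=
    div_mul_cancel₀ _ (mul_ne_zero h1 h2)
  clear_value z
  linear_combination (z * (t ^ 2 + t) + t ^ 3 - 3 * t ^ 2 - i * (t ^ 3 + 1 - z * (t + 1))) * hz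
    + (t ^ 3 + 1 - z * (t + 1)) ^ 2 * hi
end

section
/- Let K be a field of characteristic different from 2 containing an element i with i² = −1, and let z ∈ K. Then the polynomial 2T⁶ + 2(z−3)T⁵ + (z−3)²T⁴ + 2(z² − 4z + 1)T³ + 2z²T² + 2z(z−1)T + (z−1)² ∈ K[T] is reducible: it factors as a product of two nonconstant polynomials in K[T]. -/
open Polynomial

/-- Over any field of characteristic different from 2 containing a square
root of −1, the degree-six polynomial
`2T⁶ + 2(z−3)T⁵ + (z−3)²T⁴ + 2(z²−4z+1)T³ + 2z²T² + 2z(z−1)T + (z−1)²`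
is reducible: it is a product of two nonconstant polynomials. -/
theorem Z4_sextic_reducible (K : Type*) [Field K] (h2 : (2 : K) ≠ 0)
    (i : K) (hi : i ^ 2 = -1) (z : K) :
    ∃ g h : Polynomial K,
      (C 2 * X ^ 6 + C (2 * (z - 3)) * X ^ 5 + C ((z - 3) ^ 2) * X ^ 4 +
          C (2 * (z ^ 2 - 4 * z + 1)) * X ^ 3 + C (2 * z ^ 2) * X ^ 2 +
          C (2 * z * (z - 1)) * X + C ((z - 1) ^ 2)) = g * h ∧
        0 < g.natDegree ∧ 0 < h.natDegree := by
  have ha : (1 - i) ≠ 0 := by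
    intro h
    apply h2
    linear_combination (1 + i) * h + hi
  have hb : (1 + i) ≠ 0 := by
    intro h
    apply h2
    linear_combination (1 - i) * h + hi
  have hC : (C i : K[X]) ^ 2 = -1 := by
    rw [← C_pow, hi]; simp
  refine ⟨C (1 - i) * X ^ 3 + C (z - 3) * X ^ 2 + C ((1 + i) * z) * X + C (i * (z - 1)),
    C (1 + i) * X ^ 3 + C (z - 3) * X ^ 2 + C ((1 - i) * z) * X + C (-i * (z - 1)), ?_, ?_, ?_⟩
  · simp only [map_mul, map_add, map_sub, map_pow, map_neg, map_one, map_ofNat]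
    linear_combination (X ^ 6 - 2 * X ^ 4 * C z - 2 * X ^ 3 * (C z - 1) + C z ^ 2 * X ^ 2
      + 2 * X * C z * (C z - 1) + (C z - 1) ^ 2) * hC
  · rw [natDegree_cubic ha]; norm_num
  · rw [natDegree_cubic hb]; norm_num
end

section
/- Let i ∈ ℂ with i² = −1, let u(t) = (1 + it)/(t + i), let t ∈ ℂ with t ∉ {0, i, −i}, and set z = t + 1/t + 4t/(1+t²) − 1/2. Then one has the polynomial identity in the variable T: (2T⁴ − T³ + 12T² − T + 2) − 2z(T³ + T) = 2(T − t)(T − u(t))(T − 1/t)(T − 1/u(t)). In particular t is a root of the quartic (2T⁴ − T³ + 12T² − T + 2) − 2z(T³ + T), and its roots form the orbit {t, u(t), u²(t) = 1/t, u³(t) = 1/u(t)} of the order-4 automorphism u. -/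
open Polynomial

/-- For the stratum `Z₁`: with `u(t) = (1+it)/(t+i)` and
`z = t + 1/t + 4t/(1+t²) − 1/2`, one has the polynomial identity
`(2T⁴ − T³ + 12T² − T + 2) − 2z(T³ + T)
  = 2(T−t)(T−u(t))(T−1/t)(T−1/u(t))`;
in particular `t` is a root of the quartic, whose roots form the orbit
`{t, u(t), 1/t, 1/u(t)}` of the order-4 automorphism `u`. -/
theorem Z1_parameter_quartic (i : ℂ) (hi : i ^ 2 = -1)
    (t : ℂ) (ht0 : t ≠ 0) (hti : t ≠ i) (hti' : t ≠ -i) :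
    let u : ℂ → ℂ := fun s => (1 + i * s) / (s + i)
    let z : ℂ := t + 1 / t + 4 * t / (1 + t ^ 2) - 1 / 2
    ((C 2 * X ^ 4 - X ^ 3 + C 12 * X ^ 2 - X + C 2) - C (2 * z) * (X ^ 3 + X)
        = C 2 * ((X - C t) * (X - C (u t)) * (X - C (1 / t)) *
            (X - C (1 / u t)))) ∧
    (2 * t ^ 4 - t ^ 3 + 12 * t ^ 2 - t + 2) - 2 * z * (t ^ 3 + t) = 0 := by
  intro u z
  have h1 : t + i ≠ 0 := fun h => hti' (by linear_combination h)
  have h2 : t - i ≠ 0 := sub_ne_zero.mpr hti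
  have h3 : 1 + t ^ 2 ≠ 0 := by
    have : 1 + t ^ 2 = (t + i) * (t - i) := by linear_combination hi
    rw [this]
    exact mul_ne_zero h1 h2
  have h4 : 1 + i * t ≠ 0 := by
    intro h
    apply h2
    linear_combination (-i) * h + t * hi
  have hu : u t ≠ 0 := div_ne_zero h4 h1
  have e1 : t * (1 / t) = 1 := mul_one_div_cancel ht0
  have e2 : u t * (1 / u t) = 1 := mul_one_div_cancel hu
  have e3 : u t + 1 / u t = 4 * t / (1 + t ^ 2) := by
    simp only [u]
    field_simp
    linear_combination (t ^ 4 - 2 * t ^ 2 * 0 + 1 + 2 * t ^ 2 - 4 * t ^ 2) * hi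
  have e4 : (t + 1 / t) * (4 * t / (1 + t ^ 2)) = 4 := by
    field_simp
    ring
  have key : ∀ x : ℂ, (2 * x ^ 4 - x ^ 3 + 12 * x ^ 2 - x + 2) - 2 * z * (x ^ 3 + x)
      = 2 * ((x - t) * (x - u t) * (x - 1 / t) * (x - 1 / u t)) := by
    intro x
    have hz : z = (t + 1 / t) + (u t + 1 / u t) - 1 / 2 := by
      rw [e3]
    rw [← e3] at e4
    rw [hz]
    generalize 1 / t = s at *
    generalize 1 / u t = v at *
    generalize u t = w at *
    linear_combination (-2 * x ^ 2) * e4 - 2 * (x ^ 2 - (w + v) * x + w * v) * e1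
      - 2 * (x ^ 2 - (t + s) * x + 1) * e2
  refine ⟨?_, ?_⟩
  · apply Polynomial.funext
    intro x
    simpa using key x
  · rw [key t]
    ring
end

section
/- Let i ∈ ℂ with i² = −1, let t ∈ ℂ, and let F_t(X,Y,Z) = t(t+i)(X²−YZ)² − YZ(2X−Y−Z)(((i−1)t²+2t+(i+1))X − (it+1)(Y+Z)). Then the following substitution identities hold as polynomial identities: F_t(X, Y, 0) = t(t+i)·X⁴, F_t(X, 0, Z) = t(t+i)·X⁴, and F_t(X, 2X−Z, Z) = t(t+i)·(X−Z)⁴. Consequently, when t(t+i) ≠ 0, each of the three lines Z = 0, Y = 0 and 2X − Y − Z = 0 meets the quartic curve C_t : F_t = 0 in a single point — (0:1:0), (0:0:1) and (1:1:1) respectively — with intersection multiplicity 4, so these lines are the tangent lines at three hyperflexes of C_t. -/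
open MvPolynomial

/-- The quartic `F_t` defining the family `C_t` parametrizing the stratum
`Z₄`, in variables `X = X 0`, `Y = X 1`, `Z = X 2`. -/
noncomputable def Fquartic (i t : ℂ) : MvPolynomial (Fin 3) ℂ :=
  C (t * (t + i)) * (X 0 ^ 2 - X 1 * X 2) ^ 2 -
    X 1 * X 2 * (C 2 * X 0 - X 1 - X 2) *
      (C ((i - 1) * t ^ 2 + 2 * t + (i + 1)) * X 0 - C (i * t + 1) * (X 1 + X 2))

/-- The three substitution identities `F_t(X,Y,0) = t(t+i)X⁴`,
`F_t(X,0,Z) = t(t+i)X⁴`, `F_t(X,2X−Z,Z) = t(t+i)(X−Z)⁴`; consequently, when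
`t(t+i) ≠ 0`, the lines `Z = 0`, `Y = 0`, `2X−Y−Z = 0` meet the quartic
`C_t : F_t = 0` only in the single points `(0:1:0)`, `(0:0:1)`, `(1:1:1)`
respectively (with intersection multiplicity 4), so these lines are the
tangent lines at three hyperflexes of `C_t`. -/
theorem Z4_family_hyperflexes (i t : ℂ) (hi : i ^ 2 = -1) :
    (MvPolynomial.bind₁ ![X 0, X 1, 0] (Fquartic i t)
        = C (t * (t + i)) * X 0 ^ 4) ∧
    (MvPolynomial.bind₁ ![X 0, 0, X 2] (Fquartic i t)
        = C (t * (t + i)) * X 0 ^ 4) ∧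
    (MvPolynomial.bind₁ ![X 0, C 2 * X 0 - X 2, X 2] (Fquartic i t)
        = C (t * (t + i)) * (X 0 - X 2) ^ 4) ∧
    (t * (t + i) ≠ 0 →
      (∀ p : Fin 3 → ℂ, p ≠ 0 → p 2 = 0 →
          MvPolynomial.eval p (Fquartic i t) = 0 →
            ∃ c : ℂ, c ≠ 0 ∧ p = c • ![0, 1, 0]) ∧
      (∀ p : Fin 3 → ℂ, p ≠ 0 → p 1 = 0 →
          MvPolynomial.eval p (Fquartic i t) = 0 →
            ∃ c : ℂ, c ≠ 0 ∧ p = c • ![0, 0, 1]) ∧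
      (∀ p : Fin 3 → ℂ, p ≠ 0 → 2 * p 0 - p 1 - p 2 = 0 →
          MvPolynomial.eval p (Fquartic i t) = 0 →
            ∃ c : ℂ, c ≠ 0 ∧ p = c • ![1, 1, 1])) := by
  
  refine ⟨?_, ?_, ?_, ?_⟩
  · simp only [Fquartic, map_sub, map_mul, map_add, map_pow, bind₁_X_right, bind₁_C_right,
      Matrix.cons_val]
    ring
  · simp only [Fquartic, map_sub, map_mul, map_add, map_pow, bind₁_X_right, bind₁_C_right,
      Matrix.cons_val]
    ring
  · simp only [Fquartic, map_sub, map_mul, map_add, map_pow, bind₁_X_right, bind₁_C_right,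
      Matrix.cons_val]
    simp only [map_ofNat]
    ring
  intro ht
  refine ⟨?_, ?_, ?_⟩
  · intro p hp h2 he
    have h : t * (t + i) * p 0 ^ 4 = 0 := by
      simp only [Fquartic, map_sub, map_mul, map_add, map_pow, eval_X, eval_C, h2] at he
      linear_combination he
    have h0 : p 0 = 0 := by simpa using (mul_eq_zero.mp h).resolve_left ht
    have hpe : p = p 1 • ![0, 1, 0] := by
      ext j; fin_cases j <;> simp [h0, h2]
    refine ⟨p 1, fun h1 => hp ?_, hpe⟩
    rw [hpe, h1, zero_smul]
  · intro p hp h1 he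
    have h : t * (t + i) * p 0 ^ 4 = 0 := by
      simp only [Fquartic, map_sub, map_mul, map_add, map_pow, eval_X, eval_C, h1] at he
      linear_combination he
    have h0 : p 0 = 0 := by simpa using (mul_eq_zero.mp h).resolve_left ht
    have hpe : p = p 2 • ![0, 0, 1] := by
      ext j; fin_cases j <;> simp [h0, h1]
    refine ⟨p 2, fun h2 => hp ?_, hpe⟩
    rw [hpe, h2, zero_smul]
  · intro p hp hl he
    have h1 : p 1 = 2 * p 0 - p 2 := by linear_combination -hl
    have h : t * (t + i) * (p 0 - p 2) ^ 4 = 0 := by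
      simp only [Fquartic, map_sub, map_mul, map_add, map_pow, eval_X, eval_C, h1] at he
      linear_combination he
    have h0 : p 0 - p 2 = 0 := by
      exact pow_eq_zero_iff (four_ne_zero) |>.mp ((mul_eq_zero.mp h).resolve_left ht)
    have h02 : p 0 = p 2 := sub_eq_zero.mp h0
    have h12 : p 1 = p 2 := by rw [h1, h02]; ring
    have hpe : p = p 2 • ![1, 1, 1] := by
      ext j; fin_cases j <;> simp [h02, h12]
    refine ⟨p 2, fun h2 => hp ?_, hpe⟩
    rw [hpe, h2, zero_smul]
end
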